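/- The reticulation functor preserves finite direct products: let A₁, …, Aₙ be residuated lattices, let (Lᵢ, λᵢ) be a reticulation of Aᵢ for each i, and let A = ∏ᵢ Aᵢ be the product residuated lattice. Then the product lattice ∏ᵢ Lᵢ together with the map λ : A → ∏ᵢ Lᵢ given by λ(a₁, …, aₙ) = (λ₁(a₁), …, λₙ(aₙ)) is a reticulation of A. -/

import Mathlib

/-- A residuated lattice: a bounded lattice with a commutative monoid operation `mul`
(with unit `⊤`) and a residuum `himp` satisfying residuation. -/
class ResiduatedLattice (A : Type*) extends Lattice A, BoundedOrder A where
  mul : A → A → A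
  himp : A → A → A
  mul_comm : ∀ a b : A, mul a b = mul b a
  mul_assoc : ∀ a b c : A, mul (mul a b) c = mul a (mul b c)
  mul_top : ∀ a : A, mul a ⊤ = a
  residuation : ∀ a b c : A, a ≤ himp b c ↔ mul a b ≤ c

namespace ResiduatedLattice

variable {A : Type*} [ResiduatedLattice A]

/-- Powers with respect to the monoid operation `mul`. -/
def rpow (a : A) : ℕ → A
  | 0 => ⊤
  | n + 1 => mul a (rpow a n)

end ResiduatedLattice

open ResiduatedLattice

/-- A filter of a residuated lattice: a nonempty subset closed under `mul` and upward closed. -/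
def IsRLFilter {A : Type*} [ResiduatedLattice A] (F : Set A) : Prop :=
  F.Nonempty ∧ (∀ a ∈ F, ∀ b ∈ F, mul a b ∈ F) ∧ ∀ a ∈ F, ∀ b : A, a ≤ b → b ∈ F

/-- The principal filter of a residuated lattice generated by `a`:
`{b | aⁿ ≤ b for some n ≥ 1}`. -/
def rprinc {A : Type*} [ResiduatedLattice A] (a : A) : Set A :=
  {b | ∃ n : ℕ, 1 ≤ n ∧ rpow a n ≤ b}

/-- A reticulation of a residuated lattice `A`: a surjection `lam` onto a bounded
distributive lattice satisfying the five defining conditions. -/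
structure IsReticulation {A L : Type*} [ResiduatedLattice A] [DistribLattice L]
    [BoundedOrder L] (lam : A → L) : Prop where
  map_mul : ∀ a b : A, lam (mul a b) = lam a ⊓ lam b
  map_sup : ∀ a b : A, lam (a ⊔ b) = lam a ⊔ lam b
  map_bot : lam ⊥ = ⊥
  map_top : lam ⊤ = ⊤
  surj : Function.Surjective lam
  le_iff : ∀ a b : A, lam a ≤ lam b ↔ ∃ n : ℕ, 1 ≤ n ∧ rpow a n ≤ b

/-- The co-annihilator of a subset `X`: `{a | a ⊔ x = ⊤ for all x ∈ X}`. -/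
def coann {A : Type*} [Lattice A] [BoundedOrder A] (X : Set A) : Set A :=
  {a | ∀ x ∈ X, a ⊔ x = ⊤}

/-- The Boolean center: the set of complemented elements. -/
def BCenter (A : Type*) [Lattice A] [BoundedOrder A] : Set A :=
  {e | ∃ f : A, e ⊓ f = ⊥ ∧ e ⊔ f = ⊤}

/-- The componentwise residuated lattice structure on a finite product. -/
instance piResiduatedLattice {n : ℕ} (A : Fin n → Type*)
    [∀ i, ResiduatedLattice (A i)] : ResiduatedLattice (∀ i, A i) :=
  { (inferInstance : Lattice (∀ i, A i)), (inferInstance : BoundedOrder (∀ i, A i)) with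
    mul := fun f g i => ResiduatedLattice.mul (f i) (g i)
    himp := fun f g i => ResiduatedLattice.himp (f i) (g i)
    mul_comm := fun f g => funext fun i => ResiduatedLattice.mul_comm (f i) (g i)
    mul_assoc := fun f g h => funext fun i => ResiduatedLattice.mul_assoc (f i) (g i) (h i)
    mul_top := fun f => funext fun i => ResiduatedLattice.mul_top (f i)
    residuation := fun f g h => by
      constructor
      · intro hle i
        exact (ResiduatedLattice.residuation (f i) (g i) (h i)).mp (hle i)
      · intro hle i
        exact (ResiduatedLattice.residuation (f i) (g i) (h i)).mpr (hle i) }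

theorem rpow_succ_le_aux {A : Type*} [ResiduatedLattice A] (a : A) (k : ℕ) :
    rpow a (k + 1) ≤ rpow a k := by
  change mul a (rpow a k) ≤ rpow a k
  refine (ResiduatedLattice.residuation _ _ _).mp (le_trans le_top ?_)
  refine (ResiduatedLattice.residuation _ _ _).mpr ?_
  rw [ResiduatedLattice.mul_comm, ResiduatedLattice.mul_top]

theorem rpow_anti_aux {A : Type*} [ResiduatedLattice A] (a : A) : Antitone (rpow a) :=
  antitone_nat_of_succ_le (rpow_succ_le_aux a)

theorem rpow_pi_aux {n : ℕ} (A : Fin n → Type*) [∀ i, ResiduatedLattice (A i)]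
    (a : ∀ i, A i) (k : ℕ) (i : Fin n) : rpow a k i = rpow (a i) k := by
  induction k with
  | zero => rfl
  | succ k ih =>
    change mul (a i) (rpow a k i) = mul (a i) (rpow (a i) k)
    rw [ih]

/-- the reticulation functor preserves finite direct products: if
`(Lᵢ, lamᵢ)` is a reticulation of `Aᵢ` for each `i`, then the product lattice
`∏ᵢ Lᵢ` together with the componentwise map is a reticulation of `∏ᵢ Aᵢ`. -/
theorem stmt_3 {n : ℕ} (A : Fin n → Type*) (L : Fin n → Type*)
    [∀ i, ResiduatedLattice (A i)] [∀ i, DistribLattice (L i)] [∀ i, BoundedOrder (L i)]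
    (lam : ∀ i, A i → L i) (h : ∀ i, IsReticulation (lam i)) :
    IsReticulation (fun (a : ∀ i, A i) (i : Fin n) => lam i (a i)) := by
  refine ⟨?_, ?_, ?_, ?_, ?_, ?_⟩
  · intro a b
    exact funext fun i => (h i).map_mul (a i) (b i)
  · intro a b
    exact funext fun i => (h i).map_sup (a i) (b i)
  · exact funext fun i => (h i).map_bot
  · exact funext fun i => (h i).map_top
  · intro y
    choose x hx using fun i => (h i).surj (y i)
    exact ⟨x, funext hx⟩
  · intro a b
    constructor
    · intro hle
      choose k hk1 hk using fun i => ((h i).le_iff (a i) (b i)).mp (hle i)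
      refine ⟨Finset.univ.sup k + 1, Nat.le_add_left _ _, fun i => ?_⟩
      rw [rpow_pi_aux]
      exact le_trans (rpow_anti_aux (a i)
        (Nat.le_succ_of_le (Finset.le_sup (Finset.mem_univ i)))) (hk i)
    · rintro ⟨k, hk1, hk⟩ i
      refine ((h i).le_iff (a i) (b i)).mpr ⟨k, hk1, ?_⟩
      rw [← rpow_pi_aux]
      exact hk i
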